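/- arXiv:2303.14390 — 8 statements merged into one kernel-verified Lean document; each statement's English description precedes it below -/
import Mathlib

section
/- Let a transition system have states Fin n, inputs Fin m, outputs Fin p. Define indicator matrices over ℕ: H : Matrix (Fin p) (Fin n) ℕ with H o x = 1 if h x = o and H o x = 0 otherwise, and for each input u a matrix L⁽ᵘ⁾ : Matrix (Fin n) (Fin n) ℕ with L⁽ᵘ⁾ x' x = 1 if x' ∈ Σ x u and 0 otherwise. Then for every u and all o, o' : Fin p, the (o', o) entry of the matrix product H * L⁽ᵘ⁾ * Hᵀ is positive if and only if o' ∈ Σq o u. In other words, the Boolean reduction of H * L⁽ᵘ⁾ * Hᵀ is exactly the transition matrix of the quotient system for the input u. -/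
open Classical

/-- The Boolean reduction of `H * L⁽ᵘ⁾ * Hᵀ` is exactly the transition matrix of the
quotient system for the input `u`. -/
theorem quotient_transition_matrix (n m p : ℕ)
    (Tr : Fin n → Fin m → Set (Fin n)) (h : Fin n → Fin p)
    (H : Matrix (Fin p) (Fin n) ℕ)
    (hH : ∀ (o : Fin p) (x : Fin n), H o x = if h x = o then 1 else 0)
    (L : Fin m → Matrix (Fin n) (Fin n) ℕ)
    (hL : ∀ (u : Fin m) (x' x : Fin n), L u x' x = if x' ∈ Tr x u then 1 else 0) :
    ∀ (u : Fin m) (o o' : Fin p),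
      0 < (H * L u * H.transpose) o' o ↔
        ∃ x x' : Fin n, h x = o ∧ h x' = o' ∧ x' ∈ Tr x u := by
  intro u o o'
  have e1 : ∀ (o : Fin p) (x : Fin n), 0 < H o x ↔ h x = o := by
    intro o x
    rw [hH]
    split_ifs with hx <;> simp [hx]
  have e2 : ∀ (x' x : Fin n), 0 < L u x' x ↔ x' ∈ Tr x u := by
    intro x' x
    rw [hL]
    split_ifs with hx <;> simp [hx]
  have key : ∀ f : Fin n → ℕ, 0 < ∑ i, f i ↔ ∃ i, 0 < f i := by
    intro f
    simp [Finset.sum_pos_iff]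
  rw [Matrix.mul_apply, key]
  refine exists_congr fun x => ?_
  rw [CanonicallyOrderedAdd.mul_pos, Matrix.mul_apply, key, Matrix.transpose_apply, e1]
  simp only [CanonicallyOrderedAdd.mul_pos, e1, e2]
  constructor
  · rintro ⟨⟨x', a, b⟩, c⟩
    exact ⟨x', c, a, b⟩
  · rintro ⟨x', c, a, b⟩
    exact ⟨⟨x', a, b⟩, c⟩
end

section
/- Let a transition system have states Fin n, inputs Fin m, outputs Fin p, and define the indicator matrices over ℕ: H : Matrix (Fin p) (Fin n) ℕ with H o x = 1 if h x = o and 0 otherwise, and L : Matrix (Fin n) (Fin m × Fin n) ℕ with L x' (u, x) = 1 if x' ∈ Σ x u and 0 otherwise. Let I_m ⊗ Hᵀ : Matrix (Fin m × Fin n) (Fin m × Fin p) ℕ denote the Kronecker product of the m×m identity matrix with Hᵀ. Then for all o, o' : Fin p and u : Fin m, the (o', (u, o)) entry of the product H * L * (I_m ⊗ Hᵀ) is positive if and only if o' ∈ Σq o u; i.e., the Boolean reduction of H * L * (I_m ⊗ Hᵀ) is the structure matrix of the quotient system. -/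
open Classical
open Kronecker

/-- The Boolean reduction of `H * L * (I_m ⊗ Hᵀ)` is the structure matrix of the
quotient system. -/
theorem quotient_structure_matrix (n m p : ℕ)
    (Tr : Fin n → Fin m → Set (Fin n)) (h : Fin n → Fin p)
    (H : Matrix (Fin p) (Fin n) ℕ)
    (hH : ∀ (o : Fin p) (x : Fin n), H o x = if h x = o then 1 else 0)
    (L : Matrix (Fin n) (Fin m × Fin n) ℕ)
    (hL : ∀ (x' x : Fin n) (u : Fin m), L x' (u, x) = if x' ∈ Tr x u then 1 else 0) :
    ∀ (o o' : Fin p) (u : Fin m),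
      0 < (H * L * ((1 : Matrix (Fin m) (Fin m) ℕ) ⊗ₖ H.transpose)) o' (u, o) ↔
        ∃ x x' : Fin n, h x = o ∧ h x' = o' ∧ x' ∈ Tr x u := by
  intro o o' u
  rw [Nat.pos_iff_ne_zero, Matrix.mul_apply, Ne, Finset.sum_eq_zero_iff]
  simp only [Matrix.mul_apply, Matrix.kroneckerMap_apply, Matrix.transpose_apply, hH,
    Matrix.one_apply, Finset.mem_univ, true_imp_iff, Prod.forall, hL, mul_eq_zero,
    Finset.sum_eq_zero_iff, ite_eq_right_iff, one_ne_zero, imp_false]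
  constructor
  · intro hne
    by_contra hc
    apply hne
    intro v x
    by_cases hv : v = u
    · subst hv
      by_cases hx : h x = o
      · left
        intro x'
        by_cases hx' : h x' = o'
        · right
          exact fun ht => hc ⟨x, x', hx, hx', ht⟩
        · exact Or.inl hx'
      · exact Or.inr (Or.inr hx)
    · exact Or.inr (Or.inl hv)
  · rintro ⟨x, x', hx, hx', ht⟩ hall
    rcases hall u x with h1 | h1 | h1
    · rcases h1 x' with h2 | h2
      · exact h2 hx'
      · exact h2 ht
    · exact h1 rfl
    · exact h1 hx
end

section
/- Let an autonomous transition system have states Fin n and outputs Fin p, with transition map Σ : Fin n → Set (Fin n) and output map h : Fin n → Fin p. Define indicator matrices over ℕ: M : Matrix (Fin n) (Fin n) ℕ with M x' x = 1 if x' ∈ Σ x and 0 otherwise, and H : Matrix (Fin p) (Fin n) ℕ with H o x = 1 if h x = o and 0 otherwise. Then for all o, o' : Fin p, the (o', o) entry of H * M * Hᵀ is positive if and only if o' ∈ Σq o, where Σq is the quotient transition map. Hence the Boolean reduction of H * M * Hᵀ is the transition matrix of the quotient system under output equivalence. -/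
open Classical

/-- For an autonomous transition system, the Boolean reduction of `H * M * Hᵀ` is the
transition matrix of the quotient system under output equivalence. -/
theorem autonomous_quotient_matrix (n p : ℕ)
    (Tr : Fin n → Set (Fin n)) (h : Fin n → Fin p)
    (M : Matrix (Fin n) (Fin n) ℕ)
    (hM : ∀ (x' x : Fin n), M x' x = if x' ∈ Tr x then 1 else 0)
    (H : Matrix (Fin p) (Fin n) ℕ)
    (hH : ∀ (o : Fin p) (x : Fin n), H o x = if h x = o then 1 else 0) :
    ∀ (o o' : Fin p),
      0 < (H * M * H.transpose) o' o ↔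
        ∃ x x' : Fin n, h x = o ∧ h x' = o' ∧ x' ∈ Tr x := by
  intro o o'
  have pos : ∀ f : Fin n → ℕ, 0 < ∑ i, f i ↔ ∃ i, 0 < f i := by
    intro f
    rw [Finset.sum_pos_iff]
    simp
  have Hp : ∀ o x, 0 < H o x ↔ h x = o := by
    intro o x
    rw [hH]
    split_ifs with hx <;> simp [hx]
  have Mp : ∀ x' x, 0 < M x' x ↔ x' ∈ Tr x := by
    intro x' x
    rw [hM]
    split_ifs with hx <;> simp [hx]
  rw [Matrix.mul_apply, pos]
  simp only [Matrix.mul_apply, Matrix.transpose_apply, CanonicallyOrderedAdd.mul_pos, pos, Hp, Mp]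
  constructor
  · rintro ⟨x, ⟨x', h1, h2⟩, h3⟩
    exact ⟨x, x', h3, h1, h2⟩
  · rintro ⟨x, x', h3, h1, h2⟩
    exact ⟨x, ⟨x', h1, h2⟩, h3⟩
end

section
/- Simulation by the quotient can be strict: there exists a finite autonomous transition system (with state type a finite type X, transition map Σ : X → Set X, output type O, and output map h : X → O) together with a run o : ℕ → O of its quotient system such that no run x : ℕ → X of the original system with h (x 0) = o 0 satisfies h ∘ x = o. -/
/-- The quotient transition map of an autonomous system under output equivalence. -/
def quotientTransAut {X O : Type*} (Tr : X → Set X) (h : X → O) : O → Set O :=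
  fun o => {o' | ∃ x x' : X, h x = o ∧ h x' = o' ∧ x' ∈ Tr x}

/-- Simulation by the quotient can be strict: there is a finite autonomous transition
system and a run of its quotient system that is not the output trajectory of any run of
the original system starting in the corresponding output class. -/
theorem simulation_can_be_strict :
    ∃ (X O : Type) (_ : Fintype X) (Tr : X → Set X) (h : X → O) (o : ℕ → O),
      (∀ t, o (t + 1) ∈ quotientTransAut Tr h (o t)) ∧
      ¬ ∃ x : ℕ → X, (∀ t, x (t + 1) ∈ Tr (x t)) ∧ h (x 0) = o 0 ∧ h ∘ x = o := by
  -- states 0,1 output false, state 2 outputs true; 0 → 0, 1 → 2, 2 → 2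
  refine ⟨Fin 3, Bool, inferInstance, fun x => {if x = 0 then 0 else 2},
    fun x => decide (x = 2), fun t => decide (2 ≤ t), ?_, ?_⟩
  · intro t
    rcases t with _ | _ | t
    · exact ⟨0, 0, by simp, by simp, by simp⟩
    · exact ⟨1, 2, by simp, by simp, by simp⟩
    · exact ⟨2, 2, by simp, by simp, by simp⟩
  · rintro ⟨x, hx, -, ho⟩
    have h0 := hx 0
    have h1 := hx 1
    have o1 := congrFun ho 1
    have o2 := congrFun ho 2
    simp at h0 h1 o1 o2
    by_cases c : x 0 = 0
    · simp_all
    · simp_all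
end

section
/- Assume a transition system is total and its quotient system is deterministic. Then every run of the quotient lifts to a run of the original system: for every input sequence u : ℕ → U, every run o : ℕ → O of the quotient over u, and every state x₀ with h x₀ = o 0, there exists a run x : ℕ → X of the system over u with x 0 = x₀ and h ∘ x = o. Hence the quotient is a bi-simulation: the output trajectories of runs of the system starting in h⁻¹{o 0} are exactly the runs of the quotient starting at o 0. -/
/-- The quotient transition map under output equivalence. -/
def quotientTrans {X U O : Type*} (Tr : X → U → Set X) (h : X → O) : O → U → Set O :=
  fun o u => {o' | ∃ x x' : X, h x = o ∧ h x' = o' ∧ x' ∈ Tr x u}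

/-- If the system is total and its quotient is deterministic, then every run of the
quotient lifts to a run of the original system; hence the quotient is a bi-simulation:
the output trajectories of runs of the system starting in `h⁻¹ {o 0}` are exactly the
runs of the quotient starting at `o 0`. -/
theorem quotient_bisimulation_lift {X U O : Type*}
    (Tr : X → U → Set X) (h : X → O)
    (htotal : ∀ (x : X) (u : U), (Tr x u).Nonempty)
    (hdet : ∀ (o : O) (u : U), (quotientTrans Tr h o u).Subsingleton) :
    (∀ (u : ℕ → U) (o : ℕ → O),
        (∀ t, o (t + 1) ∈ quotientTrans Tr h (o t) (u t)) →
        ∀ x₀ : X, h x₀ = o 0 →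
          ∃ x : ℕ → X, x 0 = x₀ ∧ (∀ t, x (t + 1) ∈ Tr (x t) (u t)) ∧ h ∘ x = o) ∧
    (∀ (u : ℕ → U) (o₀ : O),
        {y : ℕ → O | ∃ x : ℕ → X,
            (∀ t, x (t + 1) ∈ Tr (x t) (u t)) ∧ h (x 0) = o₀ ∧ h ∘ x = y} =
        {o : ℕ → O | (∀ t, o (t + 1) ∈ quotientTrans Tr h (o t) (u t)) ∧ o 0 = o₀}) := by
  have lift : ∀ (u : ℕ → U) (o : ℕ → O),
      (∀ t, o (t + 1) ∈ quotientTrans Tr h (o t) (u t)) →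
      ∀ x₀ : X, h x₀ = o 0 →
        ∃ x : ℕ → X, x 0 = x₀ ∧ (∀ t, x (t + 1) ∈ Tr (x t) (u t)) ∧ h ∘ x = o := by
    intro u o ho x₀ hx₀
    choose f hf using htotal
    let x : ℕ → X := fun n => Nat.rec x₀ (fun t y => f y (u t)) n
    have hx : ∀ t, x (t + 1) ∈ Tr (x t) (u t) := fun t => hf (x t) (u t)
    refine ⟨x, rfl, hx, ?_⟩
    funext t
    induction t with
    | zero => exact hx₀
    | succ t ih => exact hdet (o t) (u t) ⟨x t, x (t + 1), ih, rfl, hx t⟩ (ho t)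
  refine ⟨lift, fun u o₀ => ?_⟩
  ext y
  constructor
  · rintro ⟨x, hx, h0, rfl⟩
    exact ⟨fun t => ⟨x t, x (t + 1), rfl, rfl, hx t⟩, h0⟩
  · rintro ⟨hy, h0⟩
    obtain ⟨x₀, _, hx₀, _, _⟩ := hy 0
    obtain ⟨x, hx0, hx, hxy⟩ := lift u y hy x₀ hx₀
    exact ⟨x, hx, by rw [hx0, hx₀, h0], hxy⟩
end

section
/- Let a transition system be total and deterministic. Then its quotient system is deterministic if and only if all output-equivalent states are one-step bisimilar, i.e., if and only if for all states x₁, x₂ with h x₁ = h x₂, every input u, and every x₁' ∈ Σ x₁ u, there exists x₂' ∈ Σ x₂ u with h x₁' = h x₂'. -/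
/-- For a total deterministic transition system, the quotient is deterministic iff all
output-equivalent states are one-step bisimilar. -/
theorem deterministic_quotient_iff_bisimilar {X U O : Type*}
    (Tr : X → U → Set X) (h : X → O)
    (htotal : ∀ (x : X) (u : U), (Tr x u).Nonempty)
    (hdet : ∀ (x : X) (u : U), (Tr x u).Subsingleton) :
    (∀ (o : O) (u : U), (quotientTrans Tr h o u).Subsingleton) ↔
      (∀ x₁ x₂ : X, h x₁ = h x₂ → ∀ u : U, ∀ x₁' ∈ Tr x₁ u,
        ∃ x₂' ∈ Tr x₂ u, h x₁' = h x₂') := by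
  constructor
  · intro H x₁ x₂ he u x₁' hx₁
    obtain ⟨x₂', hx₂⟩ := htotal x₂ u
    exact ⟨x₂', hx₂, H (h x₁) u ⟨x₁, x₁', rfl, rfl, hx₁⟩ ⟨x₂, x₂', he.symm, rfl, hx₂⟩⟩
  · rintro H o u a ⟨x, x', hx, rfl, hm⟩ b ⟨y, y', hy, rfl, hn⟩
    obtain ⟨z, hz, e⟩ := H x y (hx.trans hy.symm) u x' hm
    rw [e, hdet y u hz hn]
end

section
/- Aggregation by bi-simulation does not affect the dynamics of the rest of the network: suppose there exists a map Ĝ : W → V → U → W with g (G z v a) = Ĝ (g z) v a for all z : Z, v : V, a : U (i.e., the block output dynamics factors through the block output map, the deterministic-quotient/bi-simulation condition). Fix an input sequence a : ℕ → U and initial states y₀ : Y, z₀ : Z. Let (y, z) be the trajectory of the interconnection: y 0 = y₀, z 0 = z₀, y (t+1) = F (y t) (g (z t)) (a t), z (t+1) = G (z t) (k (y t)) (a t). Let (y', w) be the trajectory of the aggregated system: y' 0 = y₀, w 0 = g z₀, y' (t+1) = F (y' t) (w t) (a t), w (t+1) = Ĝ (w t) (k (y' t)) (a t). Then y' t = y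 t and w t = g (z t) for all t : ℕ. -/
/-- Aggregation by bi-simulation does not affect the dynamics of the rest of the
network: if the block output dynamics factors through the block output map, then the
trajectory of the aggregated interconnection coincides with that of the original. -/
theorem aggregation_bisimulation {Y Z W V U : Type*}
    (F : Y → W → U → Y) (G : Z → V → U → Z) (g : Z → W) (k : Y → V)
    (Ghat : W → V → U → W)
    (hfac : ∀ (z : Z) (v : V) (a : U), g (G z v a) = Ghat (g z) v a)
    (a : ℕ → U) (y₀ : Y) (z₀ : Z)
    (y : ℕ → Y) (z : ℕ → Z)
    (hy0 : y 0 = y₀) (hz0 : z 0 = z₀)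
    (hy : ∀ t, y (t + 1) = F (y t) (g (z t)) (a t))
    (hz : ∀ t, z (t + 1) = G (z t) (k (y t)) (a t))
    (y' : ℕ → Y) (w : ℕ → W)
    (hy'0 : y' 0 = y₀) (hw0 : w 0 = g z₀)
    (hy' : ∀ t, y' (t + 1) = F (y' t) (w t) (a t))
    (hw : ∀ t, w (t + 1) = Ghat (w t) (k (y' t)) (a t)) :
    ∀ t : ℕ, y' t = y t ∧ w t = g (z t) := by
  intro t
  induction t with
  | zero => exact ⟨by rw [hy'0, hy0], by rw [hw0, hz0]⟩
  | succ n ih =>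
    obtain ⟨h1, h2⟩ := ih
    exact ⟨by rw [hy', hy, h1, h2], by rw [hw, hz, hfac, h1, h2]⟩
end

section
/- If a transition system is total and its quotient system is deterministic, then the set of output trajectories from a state depends only on its output class: for any two states x₁, x₂ with h x₁ = h x₂ and any input sequence u : ℕ → U, the set of output trajectories {h ∘ x | x a run of the system over u with x 0 = x₁} equals the set {h ∘ x | x a run of the system over u with x 0 = x₂}. -/
/-- If the system is total and its quotient is deterministic, then the set of output
trajectories from a state depends only on its output class. -/
theorem output_trajectories_depend_only_on_class {X U O : Type*}
    (Tr : X → U → Set X) (h : X → O)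
    (htotal : ∀ (x : X) (u : U), (Tr x u).Nonempty)
    (hdet : ∀ (o : O) (u : U), (quotientTrans Tr h o u).Subsingleton)
    (x₁ x₂ : X) (hx : h x₁ = h x₂) (u : ℕ → U) :
    {y : ℕ → O | ∃ x : ℕ → X,
        (∀ t, x (t + 1) ∈ Tr (x t) (u t)) ∧ x 0 = x₁ ∧ h ∘ x = y} =
    {y : ℕ → O | ∃ x : ℕ → X,
        (∀ t, x (t + 1) ∈ Tr (x t) (u t)) ∧ x 0 = x₂ ∧ h ∘ x = y} := by
  have key : ∀ a b : X, h a = h b → ∀ y : ℕ → O,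
      (∃ x : ℕ → X, (∀ t, x (t + 1) ∈ Tr (x t) (u t)) ∧ x 0 = a ∧ h ∘ x = y) →
      (∃ x : ℕ → X, (∀ t, x (t + 1) ∈ Tr (x t) (u t)) ∧ x 0 = b ∧ h ∘ x = y) := by
    rintro a b hab y ⟨x, hrun, h0, rfl⟩
    choose f hf using htotal
    let z : ℕ → X := fun n => Nat.rec b (fun t p => f p (u t)) n
    have hz : ∀ t, z (t + 1) ∈ Tr (z t) (u t) := fun t => hf (z t) (u t)
    refine ⟨z, hz, rfl, ?_⟩
    funext t
    show h (z t) = h (x t)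
    induction t with
    | zero => rw [h0]; exact hab.symm
    | succ t ih =>
      exact hdet (h (x t)) (u t) ⟨z t, z (t + 1), ih, rfl, hz t⟩
        ⟨x t, x (t + 1), rfl, rfl, hrun t⟩
  ext y
  exact ⟨key x₁ x₂ hx y, key x₂ x₁ hx.symm y⟩
end
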